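/- arXiv:2001.09469 — 2 statements merged into one kernel-verified Lean document; each statement's English description precedes it below -/
import Mathlib

section
/- Let G be a graph and α a k-form on G with k ≥ 1. Define, for each v₁,...,v_k ∈ V(G), the 0-form α_{v₁...v_k}(x) = α(x,v₁,...,v_k). Then α = Σ_{v₁,...,v_k ∈ V(G)} α_{v₁...v_k} ∧ (dχ^{v₁} ∧ ⋯ ∧ dχ^{v_k}), in the sense that for every (k+1)-tuple (x₀,...,x_k) of vertices, α(x₀,...,x_k) equals the sum over all (v₁,...,v_k) ∈ V(G)^k of (α_{v₁...v_k} ∧ (dχ^{v₁} ∧ ⋯ ∧ dχ^{v_k}))(x₀,...,x_k) (only finitely many summands are nonzero at any given tuple). -/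
/-!
Discrete exterior differential calculus on (simple) graphs, following Shi–Yu.

* A tuple of vertices is a *clique tuple* if its entries are pairwise adjacent
  (hence pairwise distinct, since the graph is simple).
* A `k`-tensor is a real function of `k+1` vertex variables vanishing off
  `(k+1)`-cliques; a `k`-form is a skew-symmetric `k`-tensor.
* `tensorProd` is the tensor product, `skewSym` the skew-symmetrization,
  `wedge` the wedge product `α ∧ β = 𝒜(α ⊗ β)`, and `extD` the exterior
  differential.
-/

open Finset

attribute [local instance] Classical.propDecidable

noncomputable section

variable {V : Type*}

/-- `v₀, …, v_{n-1}` form an `n`-clique of `G` (pairwise adjacent, hence distinct). -/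
def IsCliqueTuple (G : SimpleGraph V) {n : ℕ} (v : Fin n → V) : Prop :=
  ∀ i j : Fin n, i ≠ j → G.Adj (v i) (v j)

/-- A `k`-tensor on `G`: a function of `k+1` vertex variables vanishing whenever the
arguments do not form a `(k+1)`-clique. -/
def IsTensor (G : SimpleGraph V) (k : ℕ) (f : (Fin (k + 1) → V) → ℝ) : Prop :=
  ∀ v : Fin (k + 1) → V, ¬ IsCliqueTuple G v → f v = 0

/-- A `k`-form on `G`: a `k`-tensor that is skew-symmetric in all of its variables. -/
def IsForm (G : SimpleGraph V) (k : ℕ) (f : (Fin (k + 1) → V) → ℝ) : Prop :=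
  IsTensor G k f ∧
    ∀ (σ : Equiv.Perm (Fin (k + 1))) (v : Fin (k + 1) → V),
      f (fun i => v (σ i)) = ((Equiv.Perm.sign σ : ℤ) : ℝ) * f v

/-- Tensor product of an `r`-tensor and an `s`-tensor:
`(α ⊗ β)(v₀,…,v_{r+s}) = α(v₀,…,v_r) β(v_r,…,v_{r+s})` on `(r+s+1)`-cliques, `0` otherwise. -/
def tensorProd (G : SimpleGraph V) (r s : ℕ)
    (α : (Fin (r + 1) → V) → ℝ) (β : (Fin (s + 1) → V) → ℝ) :
    (Fin (r + s + 1) → V) → ℝ :=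
  fun v =>
    if IsCliqueTuple G v then
      α (fun i => v (Fin.castLE (by omega) i)) * β (fun i => v ⟨r + i, by omega⟩)
    else 0

/-- Skew-symmetrization of a `k`-tensor:
`𝒜(f)(v₀,…,v_k) = (1/(k+1)!) ∑_{σ ∈ S_{k+1}} sgn σ · f(v_{σ(0)},…,v_{σ(k)})`. -/
def skewSym (k : ℕ) (f : (Fin (k + 1) → V) → ℝ) : (Fin (k + 1) → V) → ℝ :=
  fun v =>
    ((k + 1).factorial : ℝ)⁻¹ *
      ∑ σ : Equiv.Perm (Fin (k + 1)), ((Equiv.Perm.sign σ : ℤ) : ℝ) * f (fun i => v (σ i))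

/-- Wedge product of an `r`-form and an `s`-form: `α ∧ β = 𝒜(α ⊗ β)`. -/
def wedge (G : SimpleGraph V) (r s : ℕ)
    (α : (Fin (r + 1) → V) → ℝ) (β : (Fin (s + 1) → V) → ℝ) :
    (Fin (r + s + 1) → V) → ℝ :=
  skewSym (r + s) (tensorProd G r s α β)

/-- Exterior differential of an `r`-form:
`dα(v₀,…,v_{r+1}) = ∑ᵢ (-1)ⁱ α(v₀,…,v̂ᵢ,…,v_{r+1})` on `(r+2)`-cliques, `0` otherwise.
For a `0`-form `f` this gives `df(u,v) = f(v) - f(u)` on edges. -/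
def extD (G : SimpleGraph V) (r : ℕ) (α : (Fin (r + 1) → V) → ℝ) :
    (Fin (r + 2) → V) → ℝ :=
  fun v =>
    if IsCliqueTuple G v then
      ∑ i : Fin (r + 2), (-1 : ℝ) ^ (i : ℕ) * α (fun j => v (i.succAbove j))
    else 0

/-- Transport a function of `m` vertex variables along an equality `m = n` of arities. -/
def reindex {m n : ℕ} (h : m = n) (f : (Fin m → V) → ℝ) : (Fin n → V) → ℝ :=
  fun v => f (fun i => v (Fin.cast h i))

/-- Wedge product `f ∧ α` of a `0`-form `f : V → ℝ` with a `k`-form `α`,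
reindexed so that the result is again a function of `k+1` vertex variables. -/
def wedge0 (G : SimpleGraph V) (k : ℕ) (f : V → ℝ) (α : (Fin (k + 1) → V) → ℝ) :
    (Fin (k + 1) → V) → ℝ :=
  reindex (by omega) (wedge G 0 k (fun t => f (t 0)) α)

/-- The characteristic `0`-form `χ^v` of a vertex, as a function of one vertex variable. -/
def chi1 (v : V) : (Fin 1 → V) → ℝ := fun t => if t 0 = v then 1 else 0

/-- The `1`-form `dχ^v`. -/
def dchi (G : SimpleGraph V) (v : V) : (Fin 2 → V) → ℝ :=
  extD G 0 (chi1 v)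

/-- The iterated (left-associated) wedge `dχ^{v₁} ∧ dχ^{v₂} ∧ ⋯ ∧ dχ^{v_k}`,
a `k`-form; the empty wedge (`k = 0`) is the constant `1`. -/
def dchiWedge (G : SimpleGraph V) : ∀ k : ℕ, (Fin k → V) → (Fin (k + 1) → V) → ℝ
  | 0, _ => fun _ => 1
  | 1, vs => dchi G (vs 0)
  | (k + 2), vs =>
      wedge G (k + 1) 1 (dchiWedge G (k + 1) (fun i => vs i.castSucc))
        (dchi G (vs (Fin.last (k + 1))))

/-- The alternating sum `∑_τ sgn τ ∏ₗ fₗ(x_{τ(l+1)})`, i.e. the determinant of the matrix with rows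
`(1, f₁(xⱼ), …, f_k(xⱼ))`. -/
def altSum (k : ℕ) (f : Fin k → V → ℝ) (x : Fin (k + 1) → V) : ℝ :=
  ∑ τ : Equiv.Perm (Fin (k + 1)), ((Equiv.Perm.sign τ : ℤ) : ℝ) * ∏ l, f l (x (τ l.succ))

lemma sign_mul_self_real {n : ℕ} (τ : Equiv.Perm (Fin n)) :
    ((Equiv.Perm.sign τ : ℤ) : ℝ) * ((Equiv.Perm.sign τ : ℤ) : ℝ) = 1 := by
  rcases Int.units_eq_one_or (Equiv.Perm.sign τ) with h | h <;> simp [h]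

lemma IsCliqueTuple.comp_injective {G : SimpleGraph V} {m n : ℕ} {x : Fin n → V}
    (hx : IsCliqueTuple G x) {e : Fin m → Fin n} (he : Function.Injective e) :
    IsCliqueTuple G (fun i => x (e i)) :=
  fun _ _ hij => hx _ _ (he.ne hij)

lemma isCliqueTuple_comp_perm_iff {G : SimpleGraph V} {n : ℕ} {x : Fin n → V}
    (σ : Equiv.Perm (Fin n)) : IsCliqueTuple G (fun i => x (σ i)) ↔ IsCliqueTuple G x :=
  ⟨fun h => by simpa using h.comp_injective σ.symm.injective,
    fun h => h.comp_injective σ.injective⟩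

lemma sum_perm_apply (n : ℕ) (g : Fin (n + 1) → ℝ) (a : Fin (n + 1)) :
    ∑ τ : Equiv.Perm (Fin (n + 1)), g (τ a) = (n.factorial : ℝ) * ∑ j, g j := by
  have h0 : ∑ τ : Equiv.Perm (Fin (n + 1)), g (τ a)
      = ∑ τ : Equiv.Perm (Fin (n + 1)), g (τ 0) :=
    Fintype.sum_equiv (Equiv.mulRight (Equiv.swap 0 a)) _ _ (fun τ => by simp)
  have h1 : ∑ τ : Equiv.Perm (Fin (n + 1)), g (τ 0)
      = ∑ p : Fin (n + 1) × Equiv.Perm (Fin n), g p.1 :=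
    Fintype.sum_equiv Equiv.Perm.decomposeFin _ _ (fun τ => by
      conv_lhs => rw [← Equiv.Perm.decomposeFin.symm_apply_apply τ]
      generalize Equiv.Perm.decomposeFin τ = p
      obtain ⟨p, e⟩ := p
      simp)
  rw [h0, h1, Fintype.sum_prod_type, Finset.mul_sum]
  refine Finset.sum_congr rfl fun j _ => ?_
  simp [Fintype.card_perm]

lemma sum_sign_mul_comp_mul_right {n : ℕ} (ρ : Equiv.Perm (Fin n))
    (T : Equiv.Perm (Fin n) → ℝ) :
    ∑ σ : Equiv.Perm (Fin n), ((Equiv.Perm.sign σ : ℤ) : ℝ) * T (σ * ρ)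
      = ((Equiv.Perm.sign ρ : ℤ) : ℝ) *
        ∑ σ : Equiv.Perm (Fin n), ((Equiv.Perm.sign σ : ℤ) : ℝ) * T σ := by
  rw [Finset.mul_sum]
  refine Fintype.sum_equiv (Equiv.mulRight ρ) _ _ fun σ => ?_
  have := sign_mul_self_real ρ
  simp only [Equiv.coe_mulRight, Equiv.Perm.sign_mul, Units.val_mul, Int.cast_mul]
  linear_combination (-((Equiv.Perm.sign σ : ℤ) : ℝ) * T (σ * ρ)) * this

lemma sum_sign_mul_eq_zero {n : ℕ} {a b : Fin n} (hab : a ≠ b) (T : Equiv.Perm (Fin n) → ℝ)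
    (hT : ∀ σ, T (σ * Equiv.swap a b) = T σ) :
    ∑ σ : Equiv.Perm (Fin n), ((Equiv.Perm.sign σ : ℤ) : ℝ) * T σ = 0 := by
  have h := sum_sign_mul_comp_mul_right (Equiv.swap a b) T
  simp only [hT, Equiv.Perm.sign_swap hab] at h
  push_cast at h
  linarith

/-- Antisymmetrizing `altSum` times a function of the permutation. -/
lemma sum_sign_mul_altSum_mul (k : ℕ) (f : Fin k → V → ℝ) (x : Fin (k + 2) → V)
    (g : V → ℝ) (a : Fin (k + 2)) :
    ∑ σ : Equiv.Perm (Fin (k + 2)), ((Equiv.Perm.sign σ : ℤ) : ℝ) *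
        (altSum k f (fun i => x (σ i.castSucc)) * g (x (σ a)))
      = ∑ τ : Equiv.Perm (Fin (k + 1)), ∑ σ : Equiv.Perm (Fin (k + 2)),
          ((Equiv.Perm.sign σ : ℤ) : ℝ) * ((∏ l, f l (x (σ l.succ.castSucc))) *
            g (x (σ (τ.viaFintypeEmbedding Fin.castSuccEmb a)))) := by
  simp only [altSum, Finset.sum_mul, Finset.mul_sum]
  rw [Finset.sum_comm]
  rw [← Equiv.sum_comp (Equiv.inv (Equiv.Perm (Fin (k + 1))))]
  refine Finset.sum_congr rfl fun τ _ => ?_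
  have h := sum_sign_mul_comp_mul_right (τ.viaFintypeEmbedding Fin.castSuccEmb)
    (fun σ => (∏ l, f l (x (σ ((τ⁻¹) l.succ).castSucc))) * g (x (σ a)))
  have hτ : ∀ j : Fin (k + 1), τ.viaFintypeEmbedding Fin.castSuccEmb j.castSucc
      = (τ j).castSucc := fun j =>
    Equiv.Perm.viaFintypeEmbedding_apply_image τ Fin.castSuccEmb j
  have hinv : ∀ j, τ (τ⁻¹ j) = j := Equiv.apply_symm_apply τ
  simp only [Equiv.Perm.mul_apply, hτ, hinv,
    Equiv.Perm.viaFintypeEmbedding_sign] at h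
  refine Eq.trans ?_ h.symm
  rw [Finset.mul_sum]
  refine Finset.sum_congr rfl fun σ _ => ?_
  simp only [Equiv.inv_apply, Equiv.Perm.sign_inv]
  ring

lemma sum_sign_mul_altSum_step (k : ℕ) (f : Fin (k + 1) → V → ℝ) (x : Fin (k + 2) → V) :
    ∑ σ : Equiv.Perm (Fin (k + 2)), ((Equiv.Perm.sign σ : ℤ) : ℝ) *
        (altSum k (fun l => f l.castSucc) (fun i => x (σ i.castSucc)) *
          (f (Fin.last k) (x (σ (Fin.last (k + 1)))) -
            f (Fin.last k) (x (σ (Fin.last k).castSucc))))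
      = (k.factorial : ℝ) * (k + 2) * altSum (k + 1) f x := by
  set P : Equiv.Perm (Fin (k + 2)) → ℝ :=
    fun σ => ∏ l : Fin k, f l.castSucc (x (σ l.succ.castSucc)) with hP
  have hlast : ∀ σ : Equiv.Perm (Fin (k + 2)),
      P σ * f (Fin.last k) (x (σ (Fin.last (k + 1)))) = ∏ l, f l (x (σ l.succ)) := fun σ => by
    rw [Fin.prod_univ_castSucc]; rfl
  have hA : ∑ σ : Equiv.Perm (Fin (k + 2)), ((Equiv.Perm.sign σ : ℤ) : ℝ) *
      (altSum k (fun l => f l.castSucc) (fun i => x (σ i.castSucc)) *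
        f (Fin.last k) (x (σ (Fin.last (k + 1))))) = ((k + 1).factorial : ℝ) * altSum (k + 1) f x := by
    rw [sum_sign_mul_altSum_mul]
    have hτ : ∀ τ : Equiv.Perm (Fin (k + 1)),
        τ.viaFintypeEmbedding Fin.castSuccEmb (Fin.last (k + 1)) = Fin.last (k + 1) := fun τ =>
      Equiv.Perm.viaFintypeEmbedding_apply_notMem_range τ Fin.castSuccEmb (by
        rintro ⟨j, hj⟩
        exact (Fin.castSucc_lt_last j).ne hj)
    simp only [hτ]
    rw [Finset.sum_const, Finset.card_univ, Fintype.card_perm, Fintype.card_fin, nsmul_eq_mul]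
    congr 1
    exact Finset.sum_congr rfl fun σ _ => by rw [← hlast σ]
  have hswap : ∀ (σ : Equiv.Perm (Fin (k + 2))) (l : Fin k),
      (σ * Equiv.swap 0 (Fin.last (k + 1))) l.succ.castSucc = σ l.succ.castSucc := fun σ l => by
    rw [Equiv.Perm.mul_apply, Equiv.swap_apply_of_ne_of_ne]
    · simp [Fin.ext_iff]
    · exact (Fin.castSucc_lt_last _).ne
  have h0last : (0 : Fin (k + 2)) ≠ Fin.last (k + 1) := by simp [Fin.ext_iff]
  have hB : ∑ σ : Equiv.Perm (Fin (k + 2)), ((Equiv.Perm.sign σ : ℤ) : ℝ) *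
      (altSum k (fun l => f l.castSucc) (fun i => x (σ i.castSucc)) *
        f (Fin.last k) (x (σ (Fin.last k).castSucc))) = -((k.factorial : ℝ) * altSum (k + 1) f x) := by
    rw [sum_sign_mul_altSum_mul]
    have hτ : ∀ τ : Equiv.Perm (Fin (k + 1)),
        τ.viaFintypeEmbedding Fin.castSuccEmb (Fin.last k).castSucc = (τ (Fin.last k)).castSucc :=
      fun τ => Equiv.Perm.viaFintypeEmbedding_apply_image τ Fin.castSuccEmb _
    simp only [hτ]
    rw [sum_perm_apply k (fun j => ∑ σ : Equiv.Perm (Fin (k + 2)),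
      ((Equiv.Perm.sign σ : ℤ) : ℝ) * (P σ * f (Fin.last k) (x (σ j.castSucc))))]
    rw [Fin.sum_univ_succ, Finset.sum_eq_zero (s := Finset.univ (α := Fin k)), add_zero]
    · have h := sum_sign_mul_comp_mul_right (Equiv.swap 0 (Fin.last (k + 1)))
        (fun σ => P σ * f (Fin.last k) (x (σ (Fin.last (k + 1)))))
      simp only [hP, hswap, Equiv.Perm.sign_swap h0last] at h
      simp only [Equiv.Perm.mul_apply, Equiv.swap_apply_right] at h
      have h2 : ∑ σ : Equiv.Perm (Fin (k + 2)), ((Equiv.Perm.sign σ : ℤ) : ℝ) *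
          (P σ * f (Fin.last k) (x (σ (Fin.last (k + 1))))) = altSum (k + 1) f x :=
        Finset.sum_congr rfl fun σ _ => by rw [← hlast σ]
      rw [hP] at h2
      rw [h2] at h
      rw [Fin.castSucc_zero, hP, h]
      push_cast
      ring
    · intro l _
      refine sum_sign_mul_eq_zero h0last _ fun σ => ?_
      simp only [hP, hswap]
  simp only [mul_sub, Finset.sum_sub_distrib]
  rw [hA, hB, Nat.factorial_succ]
  push_cast
  ring

lemma dchi_apply_of_isCliqueTuple {G : SimpleGraph V} (v : V) {y : Fin 2 → V}
    (hy : IsCliqueTuple G y) :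
    dchi G v y = (if y 1 = v then 1 else 0) - (if y 0 = v then 1 else 0) := by
  rw [sub_eq_add_neg, ← neg_one_mul (ite _ _ _)]
  simp [dchi, extD, chi1, hy, Fin.sum_univ_two]

lemma altSum_one (f : Fin 1 → V → ℝ) (x : Fin 2 → V) :
    altSum 1 f x = f 0 (x 1) - f 0 (x 0) := by
  rw [altSum, ← Equiv.sum_comp Equiv.Perm.decomposeFin.symm, Fintype.sum_prod_type,
    Fin.sum_univ_two]
  simp [Equiv.Perm.decomposeFin.symm_sign, sub_eq_add_neg]

lemma dchiWedge_eq_altSum {G : SimpleGraph V} (k : ℕ) (vs : Fin k → V) {x : Fin (k + 1) → V}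
    (hx : IsCliqueTuple G x) :
    dchiWedge G k vs x
      = (k.factorial : ℝ)⁻¹ * altSum k (fun l y => if y = vs l then 1 else 0) x := by
  induction k with
  | zero => simp [dchiWedge, altSum]
  | succ k ih =>
    cases k with
    | zero => simp [dchiWedge, altSum_one, dchi_apply_of_isCliqueTuple _ hx]
    | succ k =>
      have hterm : ∀ σ : Equiv.Perm (Fin (k + 1 + 2)),
          tensorProd G (k + 1) 1 (dchiWedge G (k + 1) (fun i => vs i.castSucc))
            (dchi G (vs (Fin.last (k + 1)))) (fun i => x (σ i))
          = ((k + 1).factorial : ℝ)⁻¹ *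
            (altSum (k + 1) (fun l y => if y = vs l.castSucc then 1 else 0)
              (fun i => x (σ i.castSucc)) *
            ((if x (σ (Fin.last (k + 1 + 1))) = vs (Fin.last (k + 1)) then 1 else 0) -
              (if x (σ (Fin.last (k + 1)).castSucc) = vs (Fin.last (k + 1)) then 1 else 0))) := by
        intro σ
        have hσ := hx.comp_injective σ.injective
        rw [tensorProd, if_pos hσ, ← mul_assoc]
        congr 1
        · exact ih (fun i => vs i.castSucc) (hσ.comp_injective (Fin.castSucc_injective _))
        · exact dchi_apply_of_isCliqueTuple _
            (hσ.comp_injective (e := fun i : Fin 2 => ⟨k + 1 + i, by omega⟩)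
              (fun i j h => by simpa [Fin.ext_iff] using h))
      have hstep := sum_sign_mul_altSum_step (k + 1)
        (fun l y => if y = vs l then (1 : ℝ) else 0) x
      change ((k + 1 + 1 + 1).factorial : ℝ)⁻¹ * (∑ σ : Equiv.Perm (Fin (k + 1 + 2)), _) = _
      simp only [hterm, mul_left_comm _ (((k + 1).factorial : ℝ)⁻¹)]
      rw [← Finset.mul_sum, hstep, Nat.factorial_succ (k + 1 + 1), Nat.factorial_succ (k + 1)]
      have := Nat.factorial_ne_zero (k + 1)
      push_cast
      field_simp
      ring

lemma reindex_skewSym {m n : ℕ} (h : m = n) (T : (Fin (m + 1) → V) → ℝ) :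
    reindex (congrArg (· + 1) h) (skewSym m T) = skewSym n (reindex (congrArg (· + 1) h) T) := by
  subst h
  rfl

lemma isCliqueTuple_comp_cast_iff {G : SimpleGraph V} {m n : ℕ} (h : m = n) (x : Fin n → V) :
    IsCliqueTuple G (fun i => x (Fin.cast h i)) ↔ IsCliqueTuple G x := by
  subst h
  rfl

lemma wedge0_apply (G : SimpleGraph V) (k : ℕ) (f : V → ℝ) (β : (Fin (k + 1) → V) → ℝ)
    (x : Fin (k + 1) → V) :
    wedge0 G k f β x = skewSym k
      (fun y => if IsCliqueTuple G y then f (y 0) * β y else 0) x := by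
  rw [wedge0, wedge, reindex_skewSym (Nat.zero_add k)]
  congr 1
  funext y
  simp only [reindex, tensorProd, isCliqueTuple_comp_cast_iff]
  congr 3
  funext i
  congr 1
  simp

lemma IsForm.sum_sign_mul_cons {G : SimpleGraph V} {k : ℕ} {α : (Fin (k + 1) → V) → ℝ}
    (hα : IsForm G k α) (y : Fin (k + 1) → V) :
    ∑ τ : Equiv.Perm (Fin (k + 1)), ((Equiv.Perm.sign τ : ℤ) : ℝ) *
      α (Fin.cons (y 0) (fun l => y (τ l.succ))) = (k.factorial : ℝ) * α y := by
  have hterm : ∀ τ : Equiv.Perm (Fin (k + 1)), ((Equiv.Perm.sign τ : ℤ) : ℝ) *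
      α (Fin.cons (y 0) (fun l => y (τ l.succ))) = if τ 0 = 0 then α y else 0 := by
    intro τ
    split_ifs with h
    · have : (Fin.cons (y 0) (fun l => y (τ l.succ)) : Fin (k + 1) → V) = fun i => y (τ i) := by
        funext i
        refine Fin.cases ?_ (fun l => ?_) i <;> simp [h]
      rw [this, hα.2, ← mul_assoc, sign_mul_self_real, one_mul]
    · have h' : τ.symm 0 ≠ 0 := fun h0 => h (by rw [← h0, Equiv.apply_symm_apply, h0])
      obtain ⟨l, hl⟩ := Fin.exists_succ_eq.2 h'
      rw [hα.1, mul_zero]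
      intro hc
      have := hc 0 l.succ (Fin.succ_ne_zero l).symm
      rw [Fin.cons_zero, Fin.cons_succ, hl, Equiv.apply_symm_apply] at this
      exact this.ne rfl
  simp only [hterm]
  rw [sum_perm_apply k (fun j => if j = 0 then α y else 0)]
  simp

lemma IsForm.skewSym_eq {G : SimpleGraph V} {k : ℕ} {α : (Fin (k + 1) → V) → ℝ}
    (hα : IsForm G k α) : skewSym k α = α := by
  funext x
  simp only [skewSym, hα.2, ← mul_assoc _ _ (α x), sign_mul_self_real, one_mul]
  rw [Finset.sum_const, Finset.card_univ, Fintype.card_perm, Fintype.card_fin, nsmul_eq_mul,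
    inv_mul_cancel_left₀ (by exact_mod_cast Nat.factorial_ne_zero (k + 1))]

/-- **Expansion lemma.** For a `k`-form `α` (`k ≥ 1`),
`α = ∑_{v₁,…,v_k} α_{v₁⋯v_k} ∧ (dχ^{v₁} ∧ ⋯ ∧ dχ^{v_k})`, where
`α_{v₁⋯v_k}(x) = α(x, v₁, …, v_k)`, evaluated pointwise (the sum has finite support). -/
theorem expansion_of_forms (G : SimpleGraph V) (k : ℕ) (hk : 1 ≤ k)
    (α : (Fin (k + 1) → V) → ℝ) (hα : IsForm G k α) (x : Fin (k + 1) → V) :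
    α x = ∑ᶠ vs : Fin k → V,
      wedge0 G k (fun y => α (Fin.cons y vs)) (dchiWedge G k vs) x := by
  by_cases hx : IsCliqueTuple G x
  swap
  · rw [hα.1 x hx, finsum_eq_zero_of_forall_eq_zero]
    intro vs
    simp [wedge0_apply, skewSym, isCliqueTuple_comp_perm_iff, hx]
  have hprod : ∀ (vs : Fin k → V) (y : Fin k → V),
      ∏ l, (if y l = vs l then (1 : ℝ) else 0) = if y = vs then 1 else 0 := fun vs y => by
    rw [Finset.prod_ite_zero]
    simp [funext_iff]
  have hterm : ∀ vs : Fin k → V,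
      wedge0 G k (fun y => α (Fin.cons y vs)) (dchiWedge G k vs) x
        = ∑ σ : Equiv.Perm (Fin (k + 1)), ∑ τ : Equiv.Perm (Fin (k + 1)),
          if (fun l : Fin k => x (σ (τ l.succ))) = vs then
            ((k + 1).factorial : ℝ)⁻¹ * (((Equiv.Perm.sign σ : ℤ) : ℝ) *
              ((k.factorial : ℝ)⁻¹ * (((Equiv.Perm.sign τ : ℤ) : ℝ) *
                α (Fin.cons (x (σ 0)) (fun l => x (σ (τ l.succ))))))) else 0 := by
    intro vs
    rw [wedge0_apply, skewSym, Finset.mul_sum]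
    refine Finset.sum_congr rfl fun σ _ => ?_
    have hσ := hx.comp_injective σ.injective
    rw [if_pos hσ, dchiWedge_eq_altSum k vs hσ, altSum]
    simp only [Finset.mul_sum]
    refine Finset.sum_congr rfl fun τ _ => ?_
    rw [hprod vs (fun l => x (σ (τ l.succ)))]
    split_ifs with h
    · rw [h]; ring
    · simp
  have hval : ∀ (w : Fin k → V) (c : ℝ),
      ∑ᶠ vs : Fin k → V, (if w = vs then c else 0) = c := fun w c => by
    rw [finsum_eq_single _ w (fun vs h => if_neg h.symm), if_pos rfl]
  simp only [hterm, ← Fintype.sum_prod_type']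
  rw [finsum_sum_comm]
  · simp only [hval]
    rw [Fintype.sum_prod_type]
    have hcons := fun σ : Equiv.Perm (Fin (k + 1)) => hα.sum_sign_mul_cons (fun i => x (σ i))
    have hfac : (k.factorial : ℝ) ≠ 0 := by exact_mod_cast Nat.factorial_ne_zero k
    simp only [← Finset.mul_sum, hcons, inv_mul_cancel_left₀ hfac]
    exact (congrFun hα.skewSym_eq x).symm
  · exact fun p _ => (Set.finite_singleton _).subset fun vs h => by
      by_contra hne
      exact h (if_neg (Ne.symm hne))

end
end

section
/- Let G be a graph. For any vertices v₁,...,v_k ∈ V(G) and any x₀,x₁,...,x_k ∈ V(G) with {x₀,x₁,...,x_k} a (k+1)-clique of G: (dχ^{v₁} ∧ dχ^{v₂} ∧ ⋯ ∧ dχ^{v_k})(x₀,x₁,...,x_k) = sgn(τ)/k! if there is a permutation τ ∈ S_{k+1} with v_i = x_{τ(i)} for all i = 1,...,k, and equals 0 otherwise (i.e., if the v_i are not distinct or some v_i ∉ {x₀,...,x_k}). -/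
/-!
Discrete exterior differential calculus on (simple) graphs, following Shi–Yu.

* A tuple of vertices is a *clique tuple* if its entries are pairwise adjacent
  (hence pairwise distinct, since the graph is simple).
* A `k`-tensor is a real function of `k+1` vertex variables vanishing off
  `(k+1)`-cliques; a `k`-form is a skew-symmetric `k`-tensor.
* `tensorProd` is the tensor product, `skewSym` the skew-symmetrization,
  `wedge` the wedge product `α ∧ β = 𝒜(α ⊗ β)`, and `extD` the exterior
  differential.
-/

open Finset

attribute [local instance] Classical.propDecidable

noncomputable section

variable {V : Type*}

/-- The unnormalized value of `dχ^{v₁} ∧ ⋯ ∧ dχ^{v_k}`: the signed sum over `τ ∈ S_{k+1}` of the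
indicators of `v_i = x_{τ(i)}` for all `i`. -/
def signedMatchSum (k : ℕ) (vs : Fin k → V) (x : Fin (k + 1) → V) : ℝ :=
  ∑ σ : Equiv.Perm (Fin (k + 1)), ((Equiv.Perm.sign σ : ℤ) : ℝ) *
    ∏ i : Fin k, if x (σ i.succ) = vs i then 1 else 0

lemma IsCliqueTuple.injective {G : SimpleGraph V} {n : ℕ} {x : Fin n → V}
    (hx : IsCliqueTuple G x) : Function.Injective x := by
  intro i j h
  by_contra hij
  exact (hx i j hij).ne h

lemma IsCliqueTuple.comp {G : SimpleGraph V} {m n : ℕ} {x : Fin n → V}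
    (hx : IsCliqueTuple G x) {f : Fin m → Fin n} (hf : Function.Injective f) :
    IsCliqueTuple G (fun i => x (f i)) :=
  fun _ _ hij => hx _ _ (hf.ne hij)

lemma dchi_apply {G : SimpleGraph V} {x : Fin 2 → V} (hx : IsCliqueTuple G x) (v : V) :
    dchi G v x = (if x 1 = v then 1 else 0) - (if x 0 = v then 1 else 0) := by
  simp only [dchi, extD, if_pos hx, chi1]
  split_ifs <;> simp_all

lemma signedMatchSum_one (vs : Fin 1 → V) (x : Fin 2 → V) :
    signedMatchSum 1 vs x = (if x 1 = vs 0 then 1 else 0) - (if x 0 = vs 0 then 1 else 0) := by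
  have h : (univ : Finset (Equiv.Perm (Fin 2))) = {1, Equiv.swap 0 1} := by
    ext σ
    have : σ = 1 ∨ σ = Equiv.swap 0 1 := by
      convert (by decide : ∀ σ : Equiv.Perm (Fin 2), σ = 1 ∨ σ = Equiv.swap 0 1) σ
    simpa using this
  have hne : (1 : Equiv.Perm (Fin 2)) ≠ Equiv.swap 0 1 := by
    intro h
    simpa using congrArg (fun e : Equiv.Perm (Fin 2) => e 0) h
  rw [signedMatchSum, h, Finset.sum_pair hne]
  simp only [Equiv.Perm.sign_one, Equiv.Perm.sign_swap (zero_ne_one : (0 : Fin 2) ≠ 1)]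
  simp [sub_eq_add_neg, neg_ite]
  rfl

/-- Exchanging the two positions `0` and `last` changes the sign. -/
lemma sum_sign_mul_swap_zero_last (n : ℕ) (f : Equiv.Perm (Fin (n + 2)) → ℝ) :
    ∑ ρ : Equiv.Perm (Fin (n + 2)), ((Equiv.Perm.sign ρ : ℤ) : ℝ) *
        f (ρ * Equiv.swap 0 (Fin.last (n + 1))) =
      -∑ ρ : Equiv.Perm (Fin (n + 2)), ((Equiv.Perm.sign ρ : ℤ) : ℝ) * f ρ := by
  rw [← Finset.sum_neg_distrib]
  refine Fintype.sum_equiv (Equiv.mulRight (Equiv.swap 0 (Fin.last (n + 1)))) _ _ fun ρ => ?_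
  have h : (0 : Fin (n + 2)) ≠ Fin.last (n + 1) := (Fin.last_pos).ne
  simp [Equiv.Perm.sign_mul, Equiv.Perm.sign_swap h]

lemma sum_sign_mul_prod_mul_castSucc (n : ℕ) (p : Fin n → Fin (n + 2) → ℝ)
    (q : Fin (n + 2) → ℝ) (j : Fin (n + 1)) :
    ∑ ρ : Equiv.Perm (Fin (n + 2)), ((Equiv.Perm.sign ρ : ℤ) : ℝ) *
        ((∏ i : Fin n, p i (ρ i.succ.castSucc)) * q (ρ j.castSucc)) =
      if j = 0 then
        -∑ ρ : Equiv.Perm (Fin (n + 2)), ((Equiv.Perm.sign ρ : ℤ) : ℝ) *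
          ((∏ i : Fin n, p i (ρ i.succ.castSucc)) * q (ρ (Fin.last (n + 1))))
      else 0 := by
  have hfix : ∀ i : Fin n, Equiv.swap (0 : Fin (n + 2)) (Fin.last (n + 1)) i.succ.castSucc =
      i.succ.castSucc := fun i =>
    Equiv.swap_apply_of_ne_of_ne (by simp [Fin.ext_iff]) (Fin.castSucc_lt_last _).ne
  have key := sum_sign_mul_swap_zero_last n fun ρ =>
    (∏ i : Fin n, p i (ρ i.succ.castSucc)) * q (ρ j.castSucc)
  simp only [Equiv.Perm.mul_apply, hfix] at key
  split_ifs with hj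
  · subst hj
    rw [Fin.castSucc_zero, Equiv.swap_apply_left] at key
    rw [Fin.castSucc_zero, key, neg_neg]
  · have hj' : j.castSucc ≠ 0 := fun h => hj (Fin.castSucc_injective _ h)
    rw [Equiv.swap_apply_of_ne_of_ne hj' (Fin.castSucc_lt_last _).ne] at key
    linarith

lemma sum_sign_mul_match_castSucc (n : ℕ) (vs : Fin (n + 1) → V) (x : Fin (n + 2) → V)
    (j : Fin (n + 1)) :
    ∑ ρ : Equiv.Perm (Fin (n + 2)), ((Equiv.Perm.sign ρ : ℤ) : ℝ) *
        ((∏ i : Fin n, if x (ρ i.succ.castSucc) = vs i.castSucc then 1 else 0) *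
          if x (ρ j.castSucc) = vs (Fin.last n) then 1 else 0) =
      if j = 0 then -signedMatchSum (n + 1) vs x else 0 := by
  simp only [signedMatchSum, Fin.prod_univ_castSucc, Fin.succ_castSucc, Fin.succ_last]
  exact sum_sign_mul_prod_mul_castSucc n (fun i a => if x a = vs i.castSucc then 1 else 0)
    (fun a => if x a = vs (Fin.last n) then 1 else 0) j

lemma sum_perm_apply_eq_ite (n : ℕ) (a : Fin (n + 1)) (c : ℝ) :
    ∑ σ : Equiv.Perm (Fin (n + 1)), (if σ a = 0 then c else 0) = n.factorial * c := by
  have h : ∑ σ : Equiv.Perm (Fin (n + 1)), (if σ a = 0 then c else 0) =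
      ∑ σ : Equiv.Perm (Fin (n + 1)), (if σ 0 = a then c else 0) := by
    refine Fintype.sum_equiv (Equiv.inv _) _ _ fun σ => ?_
    have hiff : σ a = 0 ↔ σ⁻¹ 0 = a := by rw [Equiv.Perm.inv_eq_iff_eq, eq_comm]
    simp only [hiff]
    rfl
  rw [h, ← Equiv.Perm.decomposeFin.symm.sum_comp, Fintype.sum_prod_type]
  simp [Fintype.card_perm]

/-- For a fixed `σ ∈ S_{n+1}`, extended to `S_{n+2}` by fixing the last position, the
substitution `ρ ↦ ρ σ` absorbs the sign of `σ`. -/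
lemma sum_sign_mul_extend (n : ℕ) (vs : Fin (n + 1) → V) (x : Fin (n + 2) → V)
    (σ : Equiv.Perm (Fin (n + 1))) :
    ∑ ρ : Equiv.Perm (Fin (n + 2)), ((Equiv.Perm.sign ρ : ℤ) : ℝ) *
        (((Equiv.Perm.sign σ : ℤ) : ℝ) *
          (∏ i : Fin n, if x (ρ (σ i.succ).castSucc) = vs i.castSucc then 1 else 0) *
          ((if x (ρ (Fin.last (n + 1))) = vs (Fin.last n) then 1 else 0) -
            if x (ρ (Fin.last n).castSucc) = vs (Fin.last n) then 1 else 0)) =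
      signedMatchSum (n + 1) vs x +
        if σ⁻¹ (Fin.last n) = 0 then signedMatchSum (n + 1) vs x else 0 := by
  set e : Equiv.Perm (Fin (n + 2)) := σ.viaFintypeEmbedding Fin.castSuccEmb
  have he_cast : ∀ i : Fin (n + 1), e i.castSucc = (σ i).castSucc := fun i =>
    σ.viaFintypeEmbedding_apply_image Fin.castSuccEmb i
  have he_last : e (Fin.last (n + 1)) = Fin.last (n + 1) :=
    σ.viaFintypeEmbedding_apply_notMem_range Fin.castSuccEmb (by
      rintro ⟨i, hi⟩
      exact (Fin.castSucc_lt_last i).ne hi)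
  have he_sign : Equiv.Perm.sign e = Equiv.Perm.sign σ :=
    σ.viaFintypeEmbedding_sign Fin.castSuccEmb
  have h1 := sum_sign_mul_match_castSucc n vs x (σ⁻¹ (Fin.last n))
  have h2 : signedMatchSum (n + 1) vs x -
      (if σ⁻¹ (Fin.last n) = 0 then -signedMatchSum (n + 1) vs x else 0) =
      signedMatchSum (n + 1) vs x +
        if σ⁻¹ (Fin.last n) = 0 then signedMatchSum (n + 1) vs x else 0 := by
    split_ifs <;> ring
  rw [← h2, ← h1, signedMatchSum, ← Finset.sum_sub_distrib]
  have hσ : σ (σ⁻¹ (Fin.last n)) = Fin.last n := σ.apply_symm_apply _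
  refine Fintype.sum_equiv (Equiv.mulRight e) _ _ fun ρ => ?_
  simp only [Equiv.coe_mulRight, Equiv.Perm.mul_apply, Equiv.Perm.sign_mul, he_sign,
    Fin.prod_univ_castSucc, Fin.succ_castSucc, Fin.succ_last, he_cast, he_last, hσ]
  push_cast
  ring

lemma wedge_dchi_apply {G : SimpleGraph V} {n : ℕ} {x : Fin (n + 2) → V}
    (hx : IsCliqueTuple G x) (vs : Fin (n + 1) → V) {α : (Fin (n + 1) → V) → ℝ}
    (hα : ∀ y, IsCliqueTuple G y →
      α y = signedMatchSum n (fun i => vs i.castSucc) y / n.factorial) :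
    wedge G n 1 α (dchi G (vs (Fin.last n))) x =
      signedMatchSum (n + 1) vs x / (n + 1).factorial := by
  have hterm : ∀ ρ : Equiv.Perm (Fin (n + 2)),
      tensorProd G n 1 α (dchi G (vs (Fin.last n))) (fun i => x (ρ i)) =
        (n.factorial : ℝ)⁻¹ * ∑ σ : Equiv.Perm (Fin (n + 1)),
          (((Equiv.Perm.sign σ : ℤ) : ℝ) *
            (∏ i : Fin n, if x (ρ (σ i.succ).castSucc) = vs i.castSucc then 1 else 0) *
            ((if x (ρ (Fin.last (n + 1))) = vs (Fin.last n) then 1 else 0) -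
              if x (ρ (Fin.last n).castSucc) = vs (Fin.last n) then 1 else 0)) := by
    intro ρ
    have hρ : IsCliqueTuple G (fun i => x (ρ i)) := hx.comp ρ.injective
    have hρ₁ : IsCliqueTuple G (fun i : Fin (n + 1) => x (ρ i.castSucc)) :=
      hρ.comp (Fin.castSucc_injective _)
    have hρ₂ : IsCliqueTuple G (fun i : Fin 2 => x (ρ ⟨n + i, by omega⟩)) :=
      hρ.comp (f := fun i : Fin 2 => (⟨n + i, by omega⟩ : Fin (n + 2)))
        (fun i j h => by simpa [Fin.ext_iff] using h)
    have hunfold : tensorProd G n 1 α (dchi G (vs (Fin.last n))) (fun i => x (ρ i)) =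
        α (fun i : Fin (n + 1) => x (ρ i.castSucc)) *
          dchi G (vs (Fin.last n)) (fun i : Fin 2 => x (ρ ⟨n + i, by omega⟩)) := by
      rw [tensorProd, if_pos hρ]
      rfl
    rw [hunfold, hα _ hρ₁, dchi_apply hρ₂, ← Finset.sum_mul, signedMatchSum, div_eq_inv_mul,
      mul_assoc]
    rfl
  rw [wedge, skewSym]
  simp only [hterm, mul_left_comm _ ((n.factorial : ℝ)⁻¹), Finset.mul_sum]
  rw [Finset.sum_comm]
  simp only [← Finset.mul_sum, sum_sign_mul_extend]
  have hcount : ∑ σ : Equiv.Perm (Fin (n + 1)),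
      (if σ⁻¹ (Fin.last n) = 0 then signedMatchSum (n + 1) vs x else 0) =
        n.factorial * signedMatchSum (n + 1) vs x := by
    rw [← sum_perm_apply_eq_ite n (Fin.last n)]
    exact Fintype.sum_equiv (Equiv.inv _) _ _ fun σ => rfl
  rw [Finset.sum_add_distrib, hcount, Finset.sum_const, Finset.card_univ, Fintype.card_perm,
    Fintype.card_fin, nsmul_eq_mul]
  have hn : (n.factorial : ℝ) ≠ 0 := by positivity
  rw [Nat.factorial_succ (n + 1), Nat.factorial_succ n]
  push_cast
  field_simp

lemma dchiWedge_eq_signedMatchSum_div (G : SimpleGraph V) (k : ℕ) (vs : Fin k → V)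
    (x : Fin (k + 1) → V) (hx : IsCliqueTuple G x) :
    dchiWedge G k vs x = signedMatchSum k vs x / k.factorial := by
  induction k with
  | zero => simp [dchiWedge, signedMatchSum]
  | succ k ih =>
    cases k with
    | zero =>
      rw [dchiWedge, dchi_apply hx, signedMatchSum_one]
      simp
    | succ k => exact wedge_dchi_apply hx vs fun y hy => ih _ y hy

lemma perm_eq_of_apply_succ_eq {k : ℕ} {σ τ : Equiv.Perm (Fin (k + 1))}
    (h : ∀ i : Fin k, σ i.succ = τ i.succ) : σ = τ := by
  refine Equiv.Perm.ext fun i => Fin.cases ?_ h i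
  obtain ⟨j, hj⟩ := σ.surjective (τ 0)
  induction j using Fin.cases with
  | zero => exact hj
  | succ j => exact absurd (τ.injective ((h j).symm.trans hj)) (Fin.succ_ne_zero j)

/-- Value of `dχ^{v₁} ∧ ⋯ ∧ dχ^{v_k}` on a `(k+1)`-clique `(x₀,…,x_k)`: it equals
`sgn τ / k!` if `vᵢ = x_{τ(i)}` for some `τ ∈ S_{k+1}` and all `i = 1,…,k`,
and `0` otherwise. -/
theorem dchiWedge_eval (G : SimpleGraph V) (k : ℕ) (vs : Fin k → V)
    (x : Fin (k + 1) → V) (hx : IsCliqueTuple G x) :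
    (∀ τ : Equiv.Perm (Fin (k + 1)), (∀ i : Fin k, vs i = x (τ i.succ)) →
        dchiWedge G k vs x = ((Equiv.Perm.sign τ : ℤ) : ℝ) / (k.factorial : ℝ)) ∧
      ((¬ ∃ τ : Equiv.Perm (Fin (k + 1)), ∀ i : Fin k, vs i = x (τ i.succ)) →
        dchiWedge G k vs x = 0) := by
  rw [dchiWedge_eq_signedMatchSum_div G k vs x hx, signedMatchSum]
  constructor
  · intro τ hτ
    congr 1
    rw [Finset.sum_eq_single_of_mem τ (mem_univ τ)]
    · simp [hτ]
    · intro σ _ hστ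
      obtain ⟨i, hi⟩ : ∃ i : Fin k, σ i.succ ≠ τ i.succ := by
        by_contra! h
        exact hστ (perm_eq_of_apply_succ_eq h)
      rw [Finset.prod_eq_zero (mem_univ i), mul_zero]
      rw [hτ, if_neg (hx.injective.ne hi)]
  · intro h
    rw [Finset.sum_eq_zero, zero_div]
    intro σ _
    obtain ⟨i, hi⟩ : ∃ i : Fin k, vs i ≠ x (σ i.succ) := by
      by_contra! hσ
      exact h ⟨σ, hσ⟩
    rw [Finset.prod_eq_zero (mem_univ i) (if_neg hi.symm), mul_zero]

end
end
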